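/- Let (Z,ρ₀) be an antipodal space. Then the metric space (M(Z), d_M) is proper, i.e. every closed bounded ball in M(Z) is compact; in particular M(Z) is a complete metric space. -/

import Mathlib

open Filter Topology
open scoped Classical

variable {Z : Type*}

/-- `Z` has at least four points. -/
def HasFourPoints (Z : Type*) : Prop :=
  ∃ a b c d : Z, a ≠ b ∧ a ≠ c ∧ a ≠ d ∧ b ≠ c ∧ b ≠ d ∧ c ≠ d

/-- A separating function on `Z`: continuous, symmetric, and positive. -/
structure IsSeparating [TopologicalSpace Z] (ρ : Z → Z → ℝ) : Prop where
  continuous : Continuous fun p : Z × Z => ρ p.1 p.2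
  symm : ∀ ξ η, ρ ξ η = ρ η ξ
  nonneg : ∀ ξ η, 0 ≤ ρ ξ η
  eq_zero_iff : ∀ ξ η, ρ ξ η = 0 ↔ ξ = η

/-- The cross-ratio of a quadruple of points with respect to `ρ`. -/
noncomputable def crossRatio (ρ : Z → Z → ℝ) (ξ ξ' η η' : Z) : ℝ :=
  ρ ξ η * ρ ξ' η' / (ρ ξ η' * ρ ξ' η)

/-- Two functions are Moebius equivalent if their cross-ratios agree on all quadruples
of pairwise distinct points. -/
def MoebiusEquiv (ρ₁ ρ₂ : Z → Z → ℝ) : Prop :=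
  ∀ ξ ξ' η η' : Z, ξ ≠ ξ' → ξ ≠ η → ξ ≠ η' → ξ' ≠ η → ξ' ≠ η' → η ≠ η' →
    crossRatio ρ₁ ξ ξ' η η' = crossRatio ρ₂ ξ ξ' η η'

/-- An antipodal function on `Z`: a separating function with values in `[0,1]` such that
every point has an antipode. -/
structure IsAntipodal [TopologicalSpace Z] (ρ : Z → Z → ℝ) : Prop where
  toIsSeparating : IsSeparating ρ
  le_one : ∀ ξ η, ρ ξ η ≤ 1
  antipode : ∀ ξ, ∃ η, ρ ξ η = 1

/-- The Moebius space `M(Z, ρ₀)`: antipodal functions Moebius equivalent to `ρ₀`. -/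
def MoebiusSpace [TopologicalSpace Z] (ρ₀ : Z → Z → ℝ) : Set (Z → Z → ℝ) :=
  {ρ | IsAntipodal ρ ∧ MoebiusEquiv ρ₀ ρ}

/-- The derivative `dρ₂/dρ₁`: the (unique, when it exists) positive continuous function
satisfying the geometric mean value theorem
`ρ₂(ξ,η)² = f(ξ) f(η) ρ₁(ξ,η)²`. -/
noncomputable def mDeriv [TopologicalSpace Z] (ρ₁ ρ₂ : Z → Z → ℝ) : Z → ℝ :=
  if h : ∃ f : Z → ℝ, Continuous f ∧ (∀ ξ, 0 < f ξ) ∧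
      ∀ ξ η, ρ₂ ξ η ^ 2 = f ξ * f η * ρ₁ ξ η ^ 2
  then h.choose else fun _ => 1

/-- The metric `d_M(ρ₁, ρ₂) = ‖log (dρ₂/dρ₁)‖_∞` on the Moebius space. -/
noncomputable def dM [TopologicalSpace Z] (ρ₁ ρ₂ : Z → Z → ℝ) : ℝ :=
  ⨆ ξ : Z, |Real.log (mDeriv ρ₁ ρ₂ ξ)|

/-- The discrepancy function `D_{ρ₁}(τ)(ξ) = max_{η ≠ ξ} (τ(ξ) + τ(η) + log ρ₁(ξ,η)²)`. -/
noncomputable def discrepancy [TopologicalSpace Z] (ρ₁ : Z → Z → ℝ) (τ : C(Z, ℝ))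
    (ξ : Z) : ℝ :=
  ⨆ η : {η : Z // η ≠ ξ}, (τ ξ + τ η.1 + Real.log (ρ₁ ξ η.1 ^ 2))

/-- `E_{ρ₁}(τ)(ξ,η) = e^{τ(ξ)/2} e^{τ(η)/2} ρ₁(ξ,η)`. -/
noncomputable def eMap [TopologicalSpace Z] (ρ₁ : Z → Z → ℝ) (τ : C(Z, ℝ)) :
    Z → Z → ℝ :=
  fun ξ η => Real.exp (τ ξ / 2) * Real.exp (τ η / 2) * ρ₁ ξ η

/-- A solution of the `ρ₁`-antipodal flow `dτ_t/dt = -D_{ρ₁}(τ_t)` on `[0, ∞)`. -/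
def IsAntipodalFlowSol [TopologicalSpace Z] [CompactSpace Z]
    (ρ₁ : Z → Z → ℝ) (τ : ℝ → C(Z, ℝ)) : Prop :=
  ∀ t ∈ Set.Ici (0 : ℝ), ∃ τ' : C(Z, ℝ),
    (∀ ξ, τ' ξ = -discrepancy ρ₁ (τ t) ξ) ∧
    HasDerivWithinAt τ τ' (Set.Ici (0 : ℝ)) t

/-- The antipodalization map `P_∞(τ₀, ρ₁) = E_{ρ₁}(τ_∞)`, where `τ_∞` is the limit as
`t → ∞` of the solution of the `ρ₁`-antipodal flow starting at `τ₀`. -/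
noncomputable def antipodalization [TopologicalSpace Z] [CompactSpace Z]
    (ρ₁ : Z → Z → ℝ) (τ₀ : C(Z, ℝ)) : Z → Z → ℝ :=
  if h : ∃ p : (ℝ → C(Z, ℝ)) × C(Z, ℝ), p.1 0 = τ₀ ∧ IsAntipodalFlowSol ρ₁ p.1 ∧
      Filter.Tendsto p.1 Filter.atTop (𝓝 p.2)
  then eMap ρ₁ h.choose.2 else ρ₁


open scoped BoundedContinuousFunction

section Helpers

variable {ρ ρ' ρ₁ ρ₂ ρ₃ : Z → Z → ℝ}

lemma HasFourPoints.exists_ne_three (h : HasFourPoints Z) (x y z : Z) :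
    ∃ w, w ≠ x ∧ w ≠ y ∧ w ≠ z := by
  obtain ⟨a, b, c, d, hab, hac, had, hbc, hbd, hcd⟩ := h
  by_contra! H
  have K : ∀ w, w = x ∨ w = y ∨ w = z := fun w => by
    by_contra! h
    exact h.2.2 (H w h.1 h.2.1)
  have Ka := K a
  have Kb := K b
  have Kc := K c
  have Kd := K d
  grind

lemma MoebiusEquiv.symm (h : MoebiusEquiv ρ₁ ρ₂) : MoebiusEquiv ρ₂ ρ₁ :=
  fun ξ ξ' η η' h₁ h₂ h₃ h₄ h₅ h₆ => (h ξ ξ' η η' h₁ h₂ h₃ h₄ h₅ h₆).symm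

lemma MoebiusEquiv.trans (h : MoebiusEquiv ρ₁ ρ₂) (h' : MoebiusEquiv ρ₂ ρ₃) :
    MoebiusEquiv ρ₁ ρ₃ :=
  fun ξ ξ' η η' h₁ h₂ h₃ h₄ h₅ h₆ =>
    (h ξ ξ' η η' h₁ h₂ h₃ h₄ h₅ h₆).trans (h' ξ ξ' η η' h₁ h₂ h₃ h₄ h₅ h₆)

variable [TopologicalSpace Z]

lemma IsSeparating.pos (h : IsSeparating ρ) {ξ η : Z} (hne : ξ ≠ η) : 0 < ρ ξ η :=
  (h.nonneg ξ η).lt_of_ne fun h0 => hne ((h.eq_zero_iff ξ η).1 h0.symm)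

/-- Quotients of Moebius equivalent separating functions satisfy an exchange rule. -/
lemma MoebiusEquiv.div_mul_div (hM : MoebiusEquiv ρ₁ ρ₂) (h₁ : IsSeparating ρ₁)
    (h₂ : IsSeparating ρ₂) {a b c d : Z} (hab : a ≠ b) (hac : a ≠ c) (had : a ≠ d)
    (hbc : b ≠ c) (hbd : b ≠ d) (hcd : c ≠ d) :
    ρ₂ a c / ρ₁ a c * (ρ₂ b d / ρ₁ b d) = ρ₂ a d / ρ₁ a d * (ρ₂ b c / ρ₁ b c) := by
  have key := hM a b c d hab hac had hbc hbd hcd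
  have p1 := h₁.pos hac
  have p2 := h₁.pos hbd
  have p3 := h₁.pos had
  have p4 := h₁.pos hbc
  have p5 := h₂.pos had
  have p6 := h₂.pos hbc
  unfold crossRatio at key
  rw [div_eq_div_iff (by positivity) (by positivity)] at key
  rw [div_mul_div_comm, div_mul_div_comm, div_eq_div_iff (by positivity) (by positivity)]
  linarith

/-- The geometric mean value theorem for Moebius equivalent separating functions. -/
lemma MoebiusEquiv.exists_deriv [T1Space Z] (hM : MoebiusEquiv ρ₁ ρ₂) (h4 : HasFourPoints Z)
    (h₁ : IsSeparating ρ₁) (h₂ : IsSeparating ρ₂) :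
    ∃ f : Z → ℝ, Continuous f ∧ (∀ ξ, 0 < f ξ) ∧
      ∀ ξ η, ρ₂ ξ η ^ 2 = f ξ * f η * ρ₁ ξ η ^ 2 := by
  set q : Z → Z → ℝ := fun ξ η => ρ₂ ξ η / ρ₁ ξ η with hq
  have qpos : ∀ {ξ η}, ξ ≠ η → 0 < q ξ η := fun h => div_pos (h₂.pos h) (h₁.pos h)
  have qsymm : ∀ ξ η, q ξ η = q η ξ := fun ξ η => by simp only [hq, h₁.symm ξ η, h₂.symm ξ η]
  have exch : ∀ {a b c d : Z}, a ≠ b → a ≠ c → a ≠ d → b ≠ c → b ≠ d → c ≠ d →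
      q a c * q b d = q a d * q b c := fun h1 h2 h3 h4 h5 h6 =>
    hM.div_mul_div h₁ h₂ h1 h2 h3 h4 h5 h6
  set F : Z → Z → Z → ℝ := fun ξ a b => q ξ a * q ξ b / q a b with hF
  have Fsymm : ∀ ξ a b, F ξ a b = F ξ b a := fun ξ a b => by
    simp only [hF, qsymm a b, mul_comm]
  have step : ∀ {ξ a b c : Z}, a ≠ ξ → b ≠ ξ → c ≠ ξ → a ≠ b → a ≠ c →
      F ξ a b = F ξ a c := by
    intro ξ a b c ha hb hc hab hac
    rcases eq_or_ne b c with rfl | hbc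
    · rfl
    · have e := exch ha.symm hb.symm hc.symm hab hac hbc
      simp only [hF]
      rw [div_eq_div_iff (qpos hab).ne' (qpos hac).ne', mul_assoc, mul_assoc, e]
  have indep : ∀ {ξ a b c d : Z}, a ≠ ξ → b ≠ ξ → c ≠ ξ → d ≠ ξ → a ≠ b → c ≠ d →
      F ξ a b = F ξ c d := by
    intro ξ a b c d ha hb hc hd hab hcd
    rcases eq_or_ne c a with rfl | hca
    · exact step hc hb hd hab hcd
    · rw [step ha hb hc hab hca.symm, Fsymm, step hc ha hd hca hcd]
  have ex : ∀ ξ : Z, ∃ a b : Z, a ≠ ξ ∧ b ≠ ξ ∧ a ≠ b := by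
    intro ξ
    obtain ⟨a, ha, -, -⟩ := h4.exists_ne_three ξ ξ ξ
    obtain ⟨b, hb, hba, -⟩ := h4.exists_ne_three ξ a a
    exact ⟨a, b, ha, hb, hba.symm⟩
  choose A B hA hB hAB using ex
  have qcont : ∀ {ξ a : Z}, a ≠ ξ → ContinuousAt (fun ζ => q ζ a) ξ := by
    intro ξ a ha
    have c : Continuous fun ζ : Z => (ζ, a) := by fun_prop
    have c1 : Continuous fun ζ => ρ₁ ζ a := h₁.continuous.comp c
    have c2 : Continuous fun ζ => ρ₂ ζ a := h₂.continuous.comp c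
    exact c2.continuousAt.div c1.continuousAt (h₁.pos ha.symm).ne'
  refine ⟨fun ξ => F ξ (A ξ) (B ξ), ?_, fun ξ => ?_, fun ξ η => ?_⟩
  · rw [continuous_iff_continuousAt]
    intro ξ
    have c : ContinuousAt (fun ζ => F ζ (A ξ) (B ξ)) ξ :=
      ((qcont (hA ξ)).mul (qcont (hB ξ))).div_const _
    refine c.congr ?_
    filter_upwards [isOpen_compl_singleton.mem_nhds (hA ξ).symm,
      isOpen_compl_singleton.mem_nhds (hB ξ).symm] with ζ h h'
    exact indep (Ne.symm h) (Ne.symm h') (hA ζ) (hB ζ) (hAB ξ) (hAB ζ)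
  · exact div_pos (mul_pos (qpos (hA ξ).symm) (qpos (hB ξ).symm)) (qpos (hAB ξ))
  · rcases eq_or_ne ξ η with rfl | hne
    · simp [(h₁.eq_zero_iff ξ ξ).2 rfl, (h₂.eq_zero_iff ξ ξ).2 rfl]
    obtain ⟨a, haξ, haη, -⟩ := h4.exists_ne_three ξ η η
    have e1 : F ξ (A ξ) (B ξ) = F ξ η a := indep (hA ξ) (hB ξ) hne.symm haξ (hAB ξ) haη.symm
    have e2 : F η (A η) (B η) = F η ξ a := indep (hA η) (hB η) hne haη (hAB η) haξ.symm
    have e3 : F ξ η a * F η ξ a = q ξ η ^ 2 := by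
      have p1 := qpos haξ.symm
      have p2 := qpos haη.symm
      simp only [hF, qsymm η ξ]
      field_simp
    have p := h₁.pos hne
    change ρ₂ ξ η ^ 2 = F ξ (A ξ) (B ξ) * F η (A η) (B η) * ρ₁ ξ η ^ 2
    rw [e1, e2, e3]
    simp only [hq]
    field_simp

/-- Uniqueness in the geometric mean value theorem. -/
lemma IsSeparating.deriv_unique (h₁ : IsSeparating ρ₁) (h4 : HasFourPoints Z) {f g : Z → ℝ}
    (hf : ∀ ξ, 0 < f ξ) (hg : ∀ ξ, 0 < g ξ)
    (hf' : ∀ ξ η, ρ₂ ξ η ^ 2 = f ξ * f η * ρ₁ ξ η ^ 2)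
    (hg' : ∀ ξ η, ρ₂ ξ η ^ 2 = g ξ * g η * ρ₁ ξ η ^ 2) : f = g := by
  have e : ∀ {ξ η : Z}, ξ ≠ η → f ξ * f η = g ξ * g η := fun {ξ η} hne =>
    mul_right_cancel₀ (pow_pos (h₁.pos hne) 2).ne' ((hf' ξ η).symm.trans (hg' ξ η))
  funext ξ
  obtain ⟨a, ha, -, -⟩ := h4.exists_ne_three ξ ξ ξ
  obtain ⟨b, hb, hba, -⟩ := h4.exists_ne_three ξ a a
  have e1 := e ha.symm
  have e2 := e hb.symm
  have e3 := e hba.symm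
  have hab := mul_pos (hf a) (hf b)
  have : f ξ ^ 2 * (f a * f b) = g ξ ^ 2 * (f a * f b) := by
    calc f ξ ^ 2 * (f a * f b) = (f ξ * f a) * (f ξ * f b) := by ring
      _ = g ξ ^ 2 * (g a * g b) := by rw [e1, e2]; ring
      _ = g ξ ^ 2 * (f a * f b) := by rw [e3]
  exact (pow_left_inj₀ (hf ξ).le (hg ξ).le two_ne_zero).1 (mul_right_cancel₀ hab.ne' this)

/-- `τ` is a logarithm of the derivative of `ρ₂` with respect to `ρ₁`. -/
def HasLogDeriv (ρ₁ ρ₂ : Z → Z → ℝ) (τ : Z →ᵇ ℝ) : Prop :=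
  ∀ ξ η, ρ₂ ξ η ^ 2 = Real.exp (τ ξ) * Real.exp (τ η) * ρ₁ ξ η ^ 2

lemma HasLogDeriv.sub {τ₁ τ₂ : Z →ᵇ ℝ} (h₁ : HasLogDeriv ρ ρ₁ τ₁) (h₂ : HasLogDeriv ρ ρ₂ τ₂) :
    HasLogDeriv ρ₁ ρ₂ (τ₂ - τ₁) := by
  intro ξ η
  rw [h₁, h₂]
  simp only [BoundedContinuousFunction.coe_sub, Pi.sub_apply, Real.exp_sub]
  field_simp

lemma HasLogDeriv.dM_eq_norm {τ : Z →ᵇ ℝ} (h : HasLogDeriv ρ₁ ρ₂ τ) (h₁ : IsSeparating ρ₁)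
    (h4 : HasFourPoints Z) : dM ρ₁ ρ₂ = ‖τ‖ := by
  have hex : ∃ f : Z → ℝ, Continuous f ∧ (∀ ξ, 0 < f ξ) ∧
      ∀ ξ η, ρ₂ ξ η ^ 2 = f ξ * f η * ρ₁ ξ η ^ 2 :=
    ⟨fun ξ => Real.exp (τ ξ), by fun_prop, fun ξ => Real.exp_pos _, h⟩
  have e : mDeriv ρ₁ ρ₂ = fun ξ => Real.exp (τ ξ) := by
    rw [mDeriv, dif_pos hex]
    exact h₁.deriv_unique h4 hex.choose_spec.2.1 (fun ξ => Real.exp_pos _)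
      hex.choose_spec.2.2 h
  simp [dM, e, BoundedContinuousFunction.norm_eq_iSup_norm]

lemma MoebiusEquiv.exists_hasLogDeriv [T1Space Z] [CompactSpace Z] (hM : MoebiusEquiv ρ₁ ρ₂)
    (h4 : HasFourPoints Z) (h₁ : IsSeparating ρ₁) (h₂ : IsSeparating ρ₂) :
    ∃ τ : Z →ᵇ ℝ, HasLogDeriv ρ₁ ρ₂ τ := by
  obtain ⟨f, hf, hpos, h⟩ := hM.exists_deriv h4 h₁ h₂
  refine ⟨BoundedContinuousFunction.mkOfCompact
    ⟨fun ξ => Real.log (f ξ), hf.log fun ξ => (hpos ξ).ne'⟩, fun ξ η => ?_⟩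
  simp [Real.exp_log (hpos _), h]

/-- The logarithms of derivatives with respect to `ρ` of antipodal functions. -/
def antipodalLogs (ρ : Z → Z → ℝ) : Set (Z →ᵇ ℝ) :=
  {τ | ∀ ξ, (∀ η, Real.exp (τ ξ) * Real.exp (τ η) * ρ ξ η ^ 2 ≤ 1) ∧
    ∃ η, Real.exp (τ ξ) * Real.exp (τ η) * ρ ξ η ^ 2 = 1}

lemma HasLogDeriv.mem_antipodalLogs {τ : Z →ᵇ ℝ} (h : HasLogDeriv ρ ρ' τ)
    (h' : IsAntipodal ρ') : τ ∈ antipodalLogs ρ := by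
  intro ξ
  refine ⟨fun η => ?_, ?_⟩
  · rw [← h ξ η]
    exact pow_le_one₀ (h'.toIsSeparating.nonneg ξ η) (h'.le_one ξ η)
  · obtain ⟨η, hη⟩ := h'.antipode ξ
    exact ⟨η, by rw [← h ξ η, hη, one_pow]⟩

lemma hasLogDeriv_eMap (τ : Z →ᵇ ℝ) : HasLogDeriv ρ (eMap ρ τ.toContinuousMap) τ := by
  intro ξ η
  have e : ∀ x : ℝ, Real.exp (x / 2) ^ 2 = Real.exp x := fun x => by
    rw [← Real.exp_nat_mul]; congr 1; push_cast; ring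
  simp only [eMap, mul_pow, e]
  rfl

lemma IsSeparating.eMap (h : IsSeparating ρ) (τ : C(Z, ℝ)) : IsSeparating (eMap ρ τ) where
  continuous := by
    have := h.continuous
    unfold _root_.eMap
    fun_prop
  symm ξ η := by simp only [_root_.eMap, h.symm ξ η]; ring
  nonneg ξ η := by
    have := h.nonneg ξ η
    unfold _root_.eMap
    positivity
  eq_zero_iff ξ η := by simp [_root_.eMap, h.eq_zero_iff]

lemma moebiusEquiv_eMap (ρ : Z → Z → ℝ) (τ : C(Z, ℝ)) : MoebiusEquiv ρ (eMap ρ τ) := by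
  intro ξ ξ' η η' _ _ _ _ _ _
  set k := Real.exp (τ ξ / 2) * Real.exp (τ ξ' / 2) * Real.exp (τ η / 2) * Real.exp (τ η' / 2)
  have hk : k ≠ 0 := by positivity
  have e1 : eMap ρ τ ξ η * eMap ρ τ ξ' η' = k * (ρ ξ η * ρ ξ' η') := by
    simp only [eMap, k]; ring
  have e2 : eMap ρ τ ξ η' * eMap ρ τ ξ' η = k * (ρ ξ η' * ρ ξ' η) := by
    simp only [eMap, k]; ring
  rw [crossRatio, crossRatio, e1, e2, mul_div_mul_left _ _ hk]

lemma IsSeparating.isAntipodal_eMap (h : IsSeparating ρ) {τ : Z →ᵇ ℝ}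
    (hτ : τ ∈ antipodalLogs ρ) : IsAntipodal (_root_.eMap ρ τ.toContinuousMap) := by
  have hs := h.eMap τ.toContinuousMap
  refine ⟨hs, fun ξ η => ?_, fun ξ => ?_⟩
  · have := (hτ ξ).1 η
    rw [← hasLogDeriv_eMap τ ξ η] at this
    exact (pow_le_one_iff_of_nonneg (hs.nonneg ξ η) two_ne_zero).1 this
  · obtain ⟨η, hη⟩ := (hτ ξ).2
    rw [← hasLogDeriv_eMap τ ξ η] at hη
    exact ⟨η, (pow_eq_one_iff_of_nonneg (hs.nonneg ξ η) two_ne_zero).1 hη⟩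

lemma IsSeparating.isClosed_antipodalLogs [CompactSpace Z] (h : IsSeparating ρ) :
    IsClosed (antipodalLogs ρ) := by
  have ev : ∀ ξ : Z, Continuous fun τ : Z →ᵇ ℝ => τ ξ := fun ξ =>
    continuous_eval_const ξ
  simp only [antipodalLogs, Set.ofPred_forall, Set.ofPred_and]
  refine isClosed_iInter fun ξ => (isClosed_iInter fun η => ?_).inter ?_
  · have := ev ξ
    have := ev η
    exact isClosed_le (by fun_prop) continuous_const
  · have c1 : Continuous fun p : (Z →ᵇ ℝ) × Z => p.1 ξ := (ev ξ).comp continuous_fst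
    have c2 : Continuous fun p : (Z →ᵇ ℝ) × Z => p.1 p.2 :=
      continuous_eval
    have c3 : Continuous fun p : (Z →ᵇ ℝ) × Z => ρ ξ p.2 :=
      h.continuous.comp (by fun_prop : Continuous fun p : (Z →ᵇ ℝ) × Z => (ξ, p.2))
    have hc : IsClosed {p : (Z →ᵇ ℝ) × Z |
        Real.exp (p.1 ξ) * Real.exp (p.1 p.2) * ρ ξ p.2 ^ 2 = 1} :=
      isClosed_eq ((c1.rexp.mul c2.rexp).mul (c3.pow 2)) continuous_const
    convert isClosedMap_fst_of_compactSpace _ hc using 1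
    ext τ
    simp

lemma sub_le_of_mem_antipodalLogs {τ : Z →ᵇ ℝ} (hτ : τ ∈ antipodalLogs ρ) {r d : ℝ}
    (hr : ‖τ‖ ≤ r) {ξ ξ' : Z} (hd : ∀ η, |ρ ξ η ^ 2 - ρ ξ' η ^ 2| ≤ d) :
    τ ξ' - τ ξ ≤ Real.exp r * Real.exp r * d := by
  obtain ⟨η, hη⟩ := (hτ ξ).2
  have h' := (hτ ξ').1 η
  have bound : ∀ ζ, Real.exp (τ ζ) ≤ Real.exp r := fun ζ =>
    Real.exp_le_exp.2 ((le_abs_self _).trans ((τ.norm_coe_le_norm ζ).trans hr))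
  have e : Real.exp (τ ξ' - τ ξ) = Real.exp (τ ξ') * Real.exp (τ η) * ρ ξ η ^ 2 := by
    rw [Real.exp_sub, div_eq_iff (Real.exp_pos _).ne']
    linear_combination -Real.exp (τ ξ') * hη
  have k : Real.exp (τ ξ') * Real.exp (τ η) * (ρ ξ η ^ 2 - ρ ξ' η ^ 2) ≤
      Real.exp r * Real.exp r * d := by
    refine mul_le_mul_of_nonneg ?_ ((le_abs_self _).trans (hd η)) ?_ ?_
    · exact mul_le_mul (bound _) (bound _) (Real.exp_pos _).le (Real.exp_pos _).le
    · positivity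
    · exact (abs_nonneg _).trans (hd η)
  linarith [Real.add_one_le_exp (τ ξ' - τ ξ)]

lemma IsSeparating.isCompact_antipodalLogs [CompactSpace Z] (h : IsSeparating ρ) (r : ℝ) :
    IsCompact (antipodalLogs ρ ∩ {τ | ‖τ‖ ≤ r}) := by
  refine BoundedContinuousFunction.arzela_ascoli₂ (Set.Icc (-r) r) isCompact_Icc _
    (h.isClosed_antipodalLogs.inter (isClosed_le continuous_norm continuous_const))
    (fun τ ξ hτ => abs_le.1 ((τ.norm_coe_le_norm ξ).trans hτ.2)) fun ξ₀ => ?_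
  let S : C(Z × Z, ℝ) := ⟨fun p => ρ p.1 p.2 ^ 2, h.continuous.pow 2⟩
  refine Metric.equicontinuousAt_of_continuity_modulus
    (fun ξ => Real.exp r * Real.exp r * dist (S.curry ξ₀) (S.curry ξ)) ?_ _ ?_
  · have c : Continuous fun ξ => Real.exp r * Real.exp r * dist (S.curry ξ₀) (S.curry ξ) := by
      fun_prop
    simpa using c.tendsto ξ₀
  · refine Eventually.of_forall fun ξ τ => ?_
    have hd : ∀ η, |ρ ξ₀ η ^ 2 - ρ ξ η ^ 2| ≤ dist (S.curry ξ₀) (S.curry ξ) := fun η =>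
      ContinuousMap.dist_apply_le_dist (f := S.curry ξ₀) (g := S.curry ξ) η
    rw [Real.dist_eq, abs_sub_le_iff]
    exact ⟨sub_le_of_mem_antipodalLogs τ.2.1 τ.2.2 fun η => abs_sub_comm (ρ ξ η ^ 2) _ ▸ hd η,
      sub_le_of_mem_antipodalLogs τ.2.1 τ.2.2 hd⟩

end Helpers

theorem statement2 [TopologicalSpace Z] [CompactSpace Z]
    [TopologicalSpace.MetrizableSpace Z] (h4 : HasFourPoints Z)
    (ρ₀ : Z → Z → ℝ) (h₀ : IsAntipodal ρ₀) :
    (∀ (ρc : MoebiusSpace ρ₀) (r : ℝ) (u : ℕ → MoebiusSpace ρ₀),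
      (∀ n, dM ρc.1 (u n).1 ≤ r) →
      ∃ (σ : MoebiusSpace ρ₀) (φ : ℕ → ℕ), StrictMono φ ∧ dM ρc.1 σ.1 ≤ r ∧
        Tendsto (fun n => dM (u (φ n)).1 σ.1) atTop (𝓝 0)) ∧
    (∀ u : ℕ → MoebiusSpace ρ₀,
      (∀ ε > (0 : ℝ), ∃ N : ℕ, ∀ m ≥ N, ∀ n ≥ N, dM (u m).1 (u n).1 < ε) →
      ∃ σ : MoebiusSpace ρ₀, Tendsto (fun n => dM (u n).1 σ.1) atTop (𝓝 0)) := by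
  have chart : ∀ ρc ρ : MoebiusSpace ρ₀, ∃ τ : Z →ᵇ ℝ, HasLogDeriv ρc.1 ρ.1 τ := fun ρc ρ =>
    (ρc.2.2.symm.trans ρ.2.2).exists_hasLogDeriv h4 ρc.2.1.toIsSeparating ρ.2.1.toIsSeparating
  have inverse : ∀ (ρc : MoebiusSpace ρ₀) (τ : Z →ᵇ ℝ), τ ∈ antipodalLogs ρc.1 →
      ∃ σ : MoebiusSpace ρ₀, HasLogDeriv ρc.1 σ.1 τ := fun ρc τ hτ =>
    ⟨⟨eMap ρc.1 τ.toContinuousMap, ρc.2.1.toIsSeparating.isAntipodal_eMap hτ,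
      ρc.2.2.trans (moebiusEquiv_eMap _ _)⟩, hasLogDeriv_eMap τ⟩
  have dist_eq : ∀ (ρc ρ ρ' : MoebiusSpace ρ₀) (τ τ' : Z →ᵇ ℝ), HasLogDeriv ρc.1 ρ.1 τ →
      HasLogDeriv ρc.1 ρ'.1 τ' → dM ρ.1 ρ'.1 = dist τ τ' := fun ρc ρ ρ' τ τ' h h' => by
    rw [(h.sub h').dM_eq_norm ρ.2.1.toIsSeparating h4, dist_comm, dist_eq_norm]
  refine ⟨fun ρc r u hu => ?_, fun u hu => ?_⟩
  · choose τ hτ using fun n => chart ρc (u n)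
    have norm_eq : ∀ {ρ τ}, HasLogDeriv ρc.1 ρ τ → dM ρc.1 ρ = ‖τ‖ := fun h =>
      h.dM_eq_norm ρc.2.1.toIsSeparating h4
    obtain ⟨t, ht, φ, hφ, hlim⟩ := (ρc.2.1.toIsSeparating.isCompact_antipodalLogs r).tendsto_subseq
      (x := τ) fun n => ⟨(hτ n).mem_antipodalLogs (u n).2.1, (norm_eq (hτ n)).symm.trans_le (hu n)⟩
    obtain ⟨σ, hσ⟩ := inverse ρc t ht.1
    refine ⟨σ, φ, hφ, (norm_eq hσ).trans_le ht.2, ?_⟩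
    simpa only [dist_eq ρc _ _ _ _ (hτ _) hσ, Function.comp_apply] using
      tendsto_iff_dist_tendsto_zero.1 hlim
  · let ρc : MoebiusSpace ρ₀ := u 0
    choose τ hτ using fun n => chart ρc (u n)
    have hc : CauchySeq τ := Metric.cauchySeq_iff.2 fun ε hε => by
      simpa only [dist_eq ρc _ _ _ _ (hτ _) (hτ _)] using hu ε hε
    obtain ⟨t, hlim⟩ := cauchySeq_tendsto_of_complete hc
    obtain ⟨σ, hσ⟩ := inverse ρc t <| ρc.2.1.toIsSeparating.isClosed_antipodalLogs.mem_of_tendsto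
      hlim (Eventually.of_forall fun n => (hτ n).mem_antipodalLogs (u n).2.1)
    refine ⟨σ, ?_⟩
    simpa only [dist_eq ρc _ _ _ _ (hτ _) hσ] using tendsto_iff_dist_tendsto_zero.1 hlim
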